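/- Let ℓ > 3 be a prime and let a ∈ F_ℓ be such that the polynomial x² − x + a divides the Deuring polynomial H_ℓ(x) in F_ℓ[x]. Then a ≠ 0 and 4a − 1 ≠ 0, and the cubic polynomial g(x) = x³ + ((1−a)/a)·x² + ((1−a)/a)·x + 1 ∈ F_ℓ[x] has discriminant Δ_g = −(4a − 1)³/a⁴, which is nonzero; in particular g is separable. -/

import Mathlib

open Polynomial

/-- The polynomial `∑ k, (m choose k)² x ^ k`, whose specialization at `m = (ℓ - 1) / 2` over
`ZMod ℓ` is the Deuring polynomial. -/
noncomputable def sqBinomialPoly (R : Type*) [CommRing R] (m : ℕ) : R[X] :=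
  ∑ k ∈ Finset.range (m + 1), C ((Nat.choose m k : R) ^ 2) * X ^ k

theorem coeff_sqBinomialPoly (R : Type*) [CommRing R] (m k : ℕ) :
    (sqBinomialPoly R m).coeff k = (Nat.choose m k : R) ^ 2 := by
  simp only [sqBinomialPoly, finsetSum_coeff, coeff_C_mul_X_pow]
  rw [Finset.sum_ite_eq]
  split_ifs with h
  · rfl
  · rw [Nat.choose_eq_zero_of_lt (by simpa using h)]
    simp

theorem natDegree_sqBinomialPoly_le (R : Type*) [CommRing R] (m : ℕ) :
    (sqBinomialPoly R m).natDegree ≤ m := by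
  rw [natDegree_le_iff_coeff_eq_zero]
  intro k hk
  rw [coeff_sqBinomialPoly, Nat.choose_eq_zero_of_lt hk]
  simp

theorem sqBinomialPoly_ne_zero (R : Type*) [CommRing R] [Nontrivial R] (m : ℕ) :
    sqBinomialPoly R m ≠ 0 := by
  intro h
  simpa [h] using coeff_sqBinomialPoly R m 0

theorem succ_mul_choose_succ_cast (R : Type*) [CommRing R] (m k : ℕ) :
    ((k : R) + 1) * (Nat.choose m (k + 1) : R) = ((m : R) - k) * (Nat.choose m k : R) := by
  have h := Nat.choose_succ_right_eq m k
  rcases le_or_gt k m with hk | hk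
  · have h' := congrArg (Nat.cast : ℕ → R) h
    push_cast [Nat.cast_sub hk] at h'
    linear_combination h'
  · simp [Nat.choose_eq_zero_of_lt hk, Nat.choose_eq_zero_of_lt (hk.trans (Nat.lt_succ_self k))]

/-- The hypergeometric differential equation satisfied by `sqBinomialPoly`. -/
theorem sqBinomialPoly_ode (R : Type*) [CommRing R] (m : ℕ) :
    X * (1 - X) * derivative (derivative (sqBinomialPoly R m)) +
      (1 + C (2 * (m : R) - 1) * X) * derivative (sqBinomialPoly R m) -
      C ((m : R) ^ 2) * sqBinomialPoly R m = 0 := by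
  set H := sqBinomialPoly R m with hH
  have hcoeff (k : ℕ) : ((k : R) + 1) ^ 2 * H.coeff (k + 1) = ((m : R) - k) ^ 2 * H.coeff k := by
    rw [hH, coeff_sqBinomialPoly, coeff_sqBinomialPoly, ← mul_pow, ← mul_pow,
      succ_mul_choose_succ_cast]
  have hsplit : X * (1 - X) * derivative (derivative H) +
      (1 + C (2 * (m : R) - 1) * X) * derivative H - C ((m : R) ^ 2) * H =
      X * derivative (derivative H) - X * (X * derivative (derivative H)) + derivative H +
      C (2 * (m : R) - 1) * (X * derivative H) - C ((m : R) ^ 2) * H := by ring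
  rw [hsplit]
  ext k
  have h := hcoeff k
  rcases k with _ | _ | k <;>
  · simp only [coeff_add, coeff_sub, coeff_C_mul, coeff_X_mul, coeff_X_mul_zero, coeff_derivative,
      coeff_zero] at h ⊢
    push_cast at h ⊢
    linear_combination h

/-- A nonzero solution of a second-order equation `A f'' + B f' + D f = 0` of degree less than the
characteristic has no multiple root where `A` does not vanish. -/
theorem not_sq_dvd_of_ode {K : Type*} [Field K] {p : ℕ} [CharP K p] {A B D f : K[X]} {c : K}
    (hode : A * derivative (derivative f) + B * derivative f + D * f = 0) (hA : A.eval c ≠ 0)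
    (hf : f ≠ 0) (hdeg : f.natDegree < p) : ¬ (X - C c) ^ 2 ∣ f := by
  intro hdvd
  obtain ⟨Q, hQ, hndvd⟩ := exists_eq_pow_rootMultiplicity_mul_and_not_dvd f hf c
  have htwo : 2 ≤ f.rootMultiplicity c := (le_rootMultiplicity_iff hf).2 hdvd
  have hle : f.rootMultiplicity c < p :=
    (by simpa using natDegree_le_of_dvd (pow_rootMultiplicity_dvd f c) hf :
      f.rootMultiplicity c ≤ f.natDegree).trans_lt hdeg
  obtain ⟨n, hn⟩ := Nat.exists_eq_add_of_le' htwo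
  rw [hn] at hQ hle
  have hcast {j : ℕ} (hj : 0 < j) (hjp : j < p) : (j : K) ≠ 0 := fun h =>
    Nat.not_dvd_of_pos_of_lt hj hjp ((CharP.cast_eq_zero_iff K p j).1 h)
  have hprod : (X - C c) ^ n * (A * (C (((n + 2 : ℕ) : K) * ((n + 1 : ℕ) : K)) * Q) +
      (X - C c) * (A * (2 * C ((n + 2 : ℕ) : K) * derivative Q +
        (X - C c) * derivative (derivative Q)) +
      B * (C ((n + 2 : ℕ) : K) * Q + (X - C c) * derivative Q) + D * (X - C c) * Q)) = 0 := by
    rw [← hode, hQ]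
    simp only [derivative_mul, derivative_X_sub_C_pow, derivative_natCast,
      Nat.add_sub_cancel, show n + 2 - 1 = n + 1 by omega, map_natCast, map_add, map_mul]
    push_cast
    ring
  have hzero := (mul_eq_zero.1 hprod).resolve_left (pow_ne_zero n (X_sub_C_ne_zero c))
  have heval := congrArg (eval c) hzero
  simp only [eval_add, eval_mul, eval_sub, eval_X, eval_C, sub_self, zero_mul, add_zero,
    eval_zero, mul_eq_zero, hA, hcast (show 0 < n + 2 by omega) hle,
    hcast (show 0 < n + 1 by omega) (by omega), false_or] at heval
  exact hndvd (dvd_iff_isRoot.2 heval)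

/-- The cubic `x³ + s x² + s x + 1 = (x + 1) (x² + (s - 1) x + 1)`, of discriminant
`(s - 3)³ (s + 1)`, is separable when both factors are nonzero. -/
theorem separable_palindromic_cubic {K : Type*} [Field K] {s : K} (h3 : s - 3 ≠ 0)
    (h1 : s + 1 ≠ 0) : (X ^ 3 + C s * X ^ 2 + C s * X + C 1 : K[X]).Separable := by
  have hfac : (X ^ 3 + C s * X ^ 2 + C s * X + C 1 : K[X]) =
      (X + C 1) * (X ^ 2 + C (s - 1) * X + C 1) := by
    simp only [C_sub, C_1]
    ring
  have hinv {t : K} (ht : t ≠ 0) : (C t⁻¹ * C t : K[X]) = 1 := by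
    rw [← C_mul, inv_mul_cancel₀ ht, C_1]
  rw [hfac]
  refine (separable_X_add_C 1).mul ?_ ?_
  · rw [separable_def']
    refine ⟨C ((s - 3) * (s + 1))⁻¹ * -4,
      C ((s - 3) * (s + 1))⁻¹ * (2 * X + C (s - 1)), ?_⟩
    rw [← hinv (mul_ne_zero h3 h1)]
    have hderiv : derivative (X ^ 2 + C (s - 1) * X + C 1) = 2 * X + C (s - 1) := by
      simp [one_add_one_eq_two, C_ofNat]
    rw [hderiv]
    simp only [C_sub, C_add, C_mul, C_1, map_ofNat]
    ring
  · refine ⟨C (s - 3)⁻¹ * (X + C (s - 2)), -C (s - 3)⁻¹, ?_⟩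
    rw [← hinv h3]
    simp only [C_sub, C_1, map_ofNat]
    ring

/-- Let `ℓ > 3` be prime and `a ∈ F_ℓ` such that `x² - x + a` divides the
Deuring polynomial `H_ℓ(x) = Σ_{k=0}^{(ℓ-1)/2} ((ℓ-1)/2 choose k)² x^k`.  Then `a ≠ 0`,
`4a - 1 ≠ 0`, the cubic `g = x³ + ((1-a)/a)x² + ((1-a)/a)x + 1` has discriminant
`18pqr - 4p³r + p²q² - 4q³ - 27r²  =  -(4a-1)³/a⁴ ≠ 0` (with `p = q = (1-a)/a`, `r = 1`);
in particular `g` is separable. -/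
theorem stmt11 (ℓ : ℕ) [Fact (Nat.Prime ℓ)] (hℓ : 3 < ℓ) (a : ZMod ℓ)
    (ha : (X ^ 2 - X + C a : (ZMod ℓ)[X]) ∣
      ∑ k ∈ Finset.range ((ℓ - 1) / 2 + 1),
        C (((Nat.choose ((ℓ - 1) / 2) k : ZMod ℓ)) ^ 2) * X ^ k) :
    a ≠ 0 ∧ 4 * a - 1 ≠ 0 ∧
      (18 * ((1 - a) / a) * ((1 - a) / a) * 1 - 4 * ((1 - a) / a) ^ 3 * 1 +
          ((1 - a) / a) ^ 2 * ((1 - a) / a) ^ 2 - 4 * ((1 - a) / a) ^ 3 - 27 * 1 ^ 2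
        = -(4 * a - 1) ^ 3 / a ^ 4) ∧
      -(4 * a - 1) ^ 3 / a ^ 4 ≠ 0 ∧
      (X ^ 3 + C ((1 - a) / a) * X ^ 2 + C ((1 - a) / a) * X + C 1 : (ZMod ℓ)[X]).Separable := by
  have ha0 : a ≠ 0 := by
    rintro rfl
    obtain ⟨q, hq⟩ := ha
    have h := congrArg (coeff · 0) hq
    change (sqBinomialPoly (ZMod ℓ) _).coeff 0 = _ at h
    rw [coeff_sqBinomialPoly] at h
    simp [mul_coeff_zero] at h
  have h4 : 4 * a - 1 ≠ 0 := by
    intro h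
    have h2 : (2 : ZMod ℓ) ≠ 0 := fun h2 => one_ne_zero (α := ZMod ℓ) <| by
      linear_combination -h + 2 * a * h2
    have hsq : (X ^ 2 - X + C a : (ZMod ℓ)[X]) = (X - C (2 * a)) ^ 2 := by
      have h1 : (C (4 * a - 1) : (ZMod ℓ)[X]) = 0 := by rw [h, C_0]
      simp only [C_sub, C_mul, C_1, map_ofNat] at h1 ⊢
      linear_combination (X - C a) * h1
    rw [hsq] at ha
    refine not_sq_dvd_of_ode (p := ℓ) (A := X * (1 - X))
      (B := 1 + C (2 * (((ℓ - 1) / 2 : ℕ) : ZMod ℓ) - 1) * X)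
      (D := -C ((((ℓ - 1) / 2 : ℕ) : ZMod ℓ) ^ 2)) ?_ ?_ (sqBinomialPoly_ne_zero _ _)
      ((natDegree_sqBinomialPoly_le (ZMod ℓ) ((ℓ - 1) / 2)).trans_lt (by omega)) ha
    · linear_combination sqBinomialPoly_ode (ZMod ℓ) ((ℓ - 1) / 2)
    · have : eval (2 * a) (X * (1 - X)) = a := by
        simp only [eval_mul, eval_sub, eval_X, eval_one]
        linear_combination -a * h
      rwa [this]
  have hs3 : (1 - a) / a - 3 = -(4 * a - 1) / a := by field_simp; ring
  have hs1 : (1 - a) / a + 1 = 1 / a := by field_simp; ring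
  refine ⟨ha0, h4, ?_, ?_, ?_⟩
  · field_simp
    ring
  · rw [← Odd.neg_pow (by decide)]
    exact div_ne_zero (pow_ne_zero _ (neg_ne_zero.2 h4)) (pow_ne_zero _ ha0)
  · refine separable_palindromic_cubic ?_ ?_
    · rw [hs3]
      exact div_ne_zero (neg_ne_zero.2 h4) ha0
    · rw [hs1]
      exact div_ne_zero one_ne_zero ha0
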